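/- arXiv:1410.6708 — 2 statements merged into one kernel-verified Lean document; each statement's English description precedes it below -/
import Mathlib

section
/- The group automorphism u of M = (ℤ/4ℤ)² given by u(x, y) = (x + y, y) preserves M*, commutes with negation, and hence induces a permutation of Q that carries sections of φ to sections and induces a permutation of the 4-element set T. This induced permutation of T has no fixed points; in fact it permutes the four elements of T cyclically, i.e. for every t ∈ T one has T = {t, u·t, u²·t, u³·t}. -/
/-! Common setup: `M = (ℤ/4ℤ)²`, the sets `M*` and `M[2]*`, the quotient `Q` of `M*` by
`x ∼ −x`, and the doubling map `φ : Q → M`. -/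

/-- `M = (ℤ/4ℤ)²`. -/
abbrev Mfour := ZMod 4 × ZMod 4

/-- `M* ⊆ M`, the set of elements of additive order exactly `4`. -/
def MstarSet : Set Mfour := {x | addOrderOf x = 4}

/-- `M[2]* ⊆ M`, the set of elements of additive order exactly `2`. -/
def M2starSet : Set Mfour := {x | addOrderOf x = 2}

/-- The subtype of elements of `M` of additive order exactly `4`. -/
abbrev Mstar := {x : Mfour // x ∈ MstarSet}

/-- The equivalence relation `x ∼ y ↔ y = x ∨ y = −x` on `M*`. -/
instance negSetoid : Setoid Mstar where
  r x y := (y : Mfour) = x ∨ (y : Mfour) = -x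
  iseqv := by
    constructor
    · exact fun x => Or.inl rfl
    · rintro x y (h | h)
      · exact Or.inl h.symm
      · right; rw [h, neg_neg]
    · rintro x y z (h | h) (h' | h')
      · exact Or.inl (h'.trans h)
      · exact Or.inr (by rw [h', h])
      · exact Or.inr (h'.trans h)
      · exact Or.inl (by rw [h', h, neg_neg])

/-- `Q`, the quotient of `M*` by `x ∼ −x`. -/
abbrev Qneg := Quotient negSetoid

/-- The map `φ : Q → M` induced by `x ↦ x + x`; it takes values in `M[2]*`. -/
def phiQ : Qneg → Mfour :=
  Quotient.lift (fun x : Mstar => (x : Mfour) + (x : Mfour)) (by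
    have key : ∀ v : Mfour, -v + -v = v + v := by decide
    rintro x y (h | h)
    · show (x : Mfour) + x = (y : Mfour) + y
      rw [h]
    · show (x : Mfour) + x = (y : Mfour) + y
      rw [h]; exact (key x).symm)

/-- A subset `S ⊆ Q` is a section of `φ` if `φ` restricted to `S` is a bijection from `S`
onto `M[2]*`. -/
def IsSection (S : Set Qneg) : Prop := Set.BijOn phiQ S M2starSet

/-- The set `T` of unordered pairs `{S, Q∖S}` with `S` a section of `φ`. -/
def TSet : Set (Set (Set Qneg)) := {t | ∃ S : Set Qneg, IsSection S ∧ t = {S, Sᶜ}}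

/-- The automorphism `u(x, y) = (x + y, y)` of `M = (ℤ/4ℤ)²`, corresponding to the matrix
`(1 1; 0 1)` in `GL(2, ℤ/4ℤ)`. -/
def uAut : Mfour ≃+ Mfour where
  toFun p := (p.1 + p.2, p.2)
  invFun p := (p.1 - p.2, p.2)
  left_inv := by intro p; simp
  right_inv := by intro p; simp
  map_add' := by intro p q; simp [Prod.ext_iff]; ring

theorem mem_Mstar_iff (x : Mfour) : x ∈ MstarSet ↔ x + x ≠ 0 := by
  have h4 : ∀ v : Mfour, (2 ^ (1 + 1)) • v = 0 := by decide
  constructor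
  · intro h h0
    have h1 : addOrderOf x = 4 := h
    have h2 : addOrderOf x ∣ 2 := addOrderOf_dvd_of_nsmul_eq_zero (by rw [two_nsmul]; exact h0)
    rw [h1] at h2
    omega
  · intro h
    have : Fact (Nat.Prime 2) := ⟨Nat.prime_two⟩
    have := addOrderOf_eq_prime_pow (p := 2) (n := 1) (x := x)
      (by rw [pow_one, two_nsmul]; exact h) (h4 x)
    exact this

theorem mem_M2star_iff (x : Mfour) : x ∈ M2starSet ↔ x + x = 0 ∧ x ≠ 0 := by
  have : Fact (Nat.Prime 2) := ⟨Nat.prime_two⟩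
  have := addOrderOf_eq_prime_iff (p := 2) (x := x)
  rw [two_nsmul] at this
  exact this

/-- The class of an element of `M*`. -/
def cl (x : Mfour) (h : x + x ≠ 0) : Qneg := ⟦⟨x, (mem_Mstar_iff x).2 h⟩⟧

theorem cl_eq_iff (x y : Mfour) (hx : x + x ≠ 0) (hy : y + y ≠ 0) :
    cl x hx = cl y hy ↔ (y = x ∨ y = -x) := Quotient.eq

def qa : Qneg := cl (1, 0) (by decide)
def qa' : Qneg := cl (1, 2) (by decide)
def qb : Qneg := cl (0, 1) (by decide)
def qb' : Qneg := cl (2, 1) (by decide)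
def qc : Qneg := cl (1, 1) (by decide)
def qc' : Qneg := cl (3, 1) (by decide)

theorem q_cases (q : Qneg) : q = qa ∨ q = qa' ∨ q = qb ∨ q = qb' ∨ q = qc ∨ q = qc' := by
  induction q using Quotient.inductionOn with
  | h x =>
    obtain ⟨x, hx⟩ := x
    have hx' := (mem_Mstar_iff x).1 hx
    change cl x hx' = _ ∨ cl x hx' = _ ∨ cl x hx' = _ ∨ cl x hx' = _ ∨ cl x hx' = _ ∨ cl x hx' = _
    simp only [qa, qa', qb, qb', qc, qc', cl_eq_iff]
    clear hx
    revert x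
    decide

theorem phi_qa : phiQ qa = (2, 0) := by change ((1, 0) + (1, 0) : Mfour) = _; decide
theorem phi_qa' : phiQ qa' = (2, 0) := by change ((1, 2) + (1, 2) : Mfour) = _; decide
theorem phi_qb : phiQ qb = (0, 2) := by change ((0, 1) + (0, 1) : Mfour) = _; decide
theorem phi_qb' : phiQ qb' = (0, 2) := by change ((2, 1) + (2, 1) : Mfour) = _; decide
theorem phi_qc : phiQ qc = (2, 2) := by change ((1, 1) + (1, 1) : Mfour) = _; decide
theorem phi_qc' : phiQ qc' = (2, 2) := by change ((3, 1) + (3, 1) : Mfour) = _; decide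

theorem na : qa ≠ qa' := by rw [qa, qa', Ne, cl_eq_iff]; decide
theorem nb : qb ≠ qb' := by rw [qb, qb', Ne, cl_eq_iff]; decide
theorem nc : qc ≠ qc' := by rw [qc, qc', Ne, cl_eq_iff]; decide

theorem n1 : ((2, 0) : Mfour) ≠ (0, 2) := by decide
theorem n2 : ((2, 0) : Mfour) ≠ (2, 2) := by decide
theorem n3 : ((0, 2) : Mfour) ≠ (2, 2) := by decide

theorem M2_eq (x : Mfour) : x ∈ M2starSet ↔ x = (2, 0) ∨ x = (0, 2) ∨ x = (2, 2) := by
  rw [mem_M2star_iff]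
  revert x
  decide

theorem forall_q {P : Qneg → Prop} :
    (∀ q, P q) ↔ P qa ∧ P qa' ∧ P qb ∧ P qb' ∧ P qc ∧ P qc' := by
  constructor
  · intro h
    exact ⟨h _, h _, h _, h _, h _, h _⟩
  · rintro ⟨h1, h2, h3, h4, h5, h6⟩ q
    rcases q_cases q with rfl | rfl | rfl | rfl | rfl | rfl <;> assumption

theorem exists_q {P : Qneg → Prop} :
    (∃ q, P q) ↔ P qa ∨ P qa' ∨ P qb ∨ P qb' ∨ P qc ∨ P qc' := by
  constructor
  · rintro ⟨q, h⟩
    rcases q_cases q with rfl | rfl | rfl | rfl | rfl | rfl <;> simp only [h, true_or, or_true]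
  · rintro (h | h | h | h | h | h) <;> exact ⟨_, h⟩

set_option maxHeartbeats 2000000 in
theorem isSection_iff (S : Set Qneg) : IsSection S ↔
    (qa' ∈ S ↔ qa ∉ S) ∧ (qb' ∈ S ↔ qb ∉ S) ∧ (qc' ∈ S ↔ qc ∉ S) := by
  have hM : Set.MapsTo phiQ S M2starSet := by
    intro q _
    rw [M2_eq]
    rcases q_cases q with rfl | rfl | rfl | rfl | rfl | rfl <;>
      simp only [phi_qa, phi_qa', phi_qb, phi_qb', phi_qc, phi_qc', true_or, or_true]
  have hS : Set.SurjOn phiQ S M2starSet ↔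
      (qa ∈ S ∨ qa' ∈ S) ∧ (qb ∈ S ∨ qb' ∈ S) ∧ (qc ∈ S ∨ qc' ∈ S) := by
    simp only [Set.SurjOn, Set.subset_def, Set.mem_image, exists_q, M2_eq, forall_eq_or_imp,
      forall_eq, phi_qa, phi_qa', phi_qb, phi_qb', phi_qc, phi_qc', n1, n2, n3, n1.symm, n2.symm,
      n3.symm, and_true, and_false, or_false, false_or]
  have hI : Set.InjOn phiQ S ↔
      ¬ (qa ∈ S ∧ qa' ∈ S) ∧ ¬ (qb ∈ S ∧ qb' ∈ S) ∧ ¬ (qc ∈ S ∧ qc' ∈ S) := by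
    simp only [Set.InjOn, forall_q, phi_qa, phi_qa', phi_qb, phi_qb', phi_qc, phi_qc', n1, n2, n3,
      n1.symm, n2.symm, n3.symm, na, nb, nc, na.symm, nb.symm, nc.symm, forall_true_left,
      false_imp_iff, imp_true_iff, and_true, true_and]
    by_cases a1 : qa ∈ S <;> by_cases a2 : qb ∈ S <;> by_cases a3 : qc ∈ S <;>
    by_cases b1 : qa' ∈ S <;> by_cases b2 : qb' ∈ S <;> by_cases b3 : qc' ∈ S <;>
    simp [a1, a2, a3, b1, b2, b3]
  have : IsSection S ↔ Set.InjOn phiQ S ∧ Set.SurjOn phiQ S M2starSet :=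
    ⟨fun h => ⟨h.2.1, h.2.2⟩, fun h => ⟨hM, h.1, h.2⟩⟩
  rw [this, hS, hI]
  clear this hS hI hM
  by_cases a1 : qa ∈ S <;> by_cases a2 : qb ∈ S <;> by_cases a3 : qc ∈ S <;>
  simp [a1, a2, a3] <;> tauto

theorem set_eq_iff (S S' : Set Qneg) : S = S' ↔
    (qa ∈ S ↔ qa ∈ S') ∧ (qa' ∈ S ↔ qa' ∈ S') ∧ (qb ∈ S ↔ qb ∈ S') ∧ (qb' ∈ S ↔ qb' ∈ S') ∧
    (qc ∈ S ↔ qc ∈ S') ∧ (qc' ∈ S ↔ qc' ∈ S') := by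
  rw [Set.ext_iff, forall_q]

theorem pair_eq (A B : Set Qneg) :
    ({A, Aᶜ} : Set (Set Qneg)) = {B, Bᶜ} ↔ A = B ∨ A = Bᶜ := by
  constructor
  · intro h
    have : A ∈ ({B, Bᶜ} : Set (Set Qneg)) := by rw [← h]; exact Or.inl rfl
    exact this
  · rintro (rfl | rfl)
    · rfl
    · rw [compl_compl, Set.pair_comm]

theorem u_Mstar (x : Mfour) (h : x ∈ MstarSet) : uAut x ∈ MstarSet := by
  rw [mem_Mstar_iff] at h ⊢
  rw [← map_add]
  exact fun h' => h (EmbeddingLike.map_eq_zero_iff.1 h')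

theorem u_symm_Mstar (x : Mfour) (h : x ∈ MstarSet) : uAut.symm x ∈ MstarSet := by
  rw [mem_Mstar_iff] at h ⊢
  rw [← map_add]
  exact fun h' => h (EmbeddingLike.map_eq_zero_iff.1 h')

/-- The induced permutation of `Q`. -/
def uQ : Equiv.Perm Qneg where
  toFun := Quotient.map (fun x => ⟨uAut x.1, u_Mstar _ x.2⟩) (by
    rintro x y (h | h)
    · left; simp [h]
    · right; simp [h])
  invFun := Quotient.map (fun x => ⟨uAut.symm x.1, u_symm_Mstar _ x.2⟩) (by
    rintro x y (h | h)
    · left; simp [h]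
    · right; simp [h])
  left_inv := by
    intro q
    induction q using Quotient.inductionOn with
    | h x => simp
  right_inv := by
    intro q
    induction q using Quotient.inductionOn with
    | h x => simp

theorem us_cl (x y : Mfour) (hx : x + x ≠ 0) (hy : y + y ≠ 0) (h : x = uAut y) :
    uQ.symm (cl x hx) = cl y hy := by
  rw [Equiv.symm_apply_eq]
  subst h
  rfl

theorem us_qa : uQ.symm qa = qa := us_cl _ _ _ _ (by decide)
theorem us_qa' : uQ.symm qa' = qa' := by
  have : qa' = cl (3, 2) (by decide) := by rw [qa', cl_eq_iff]; decide
  nth_rw 1 [this]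
  exact us_cl _ _ _ _ (by decide)
theorem us_qb : uQ.symm qb = qc' := us_cl _ _ _ _ (by decide)
theorem us_qc : uQ.symm qc = qb := us_cl _ _ _ _ (by decide)
theorem us_qb' : uQ.symm qb' = qc := us_cl _ _ _ _ (by decide)
theorem us_qc' : uQ.symm qc' = qb' := us_cl _ _ _ _ (by decide)

theorem mem_img (S : Set Qneg) (q : Qneg) : q ∈ uQ '' S ↔ uQ.symm q ∈ S := by
  rw [Equiv.image_eq_preimage_symm]; rfl

theorem img_section (S : Set Qneg) (h : IsSection S) : IsSection (uQ '' S) := by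
  rw [isSection_iff] at h ⊢
  simp only [mem_img, us_qa, us_qa', us_qb, us_qb', us_qc, us_qc']
  tauto

theorem img_pair (S : Set Qneg) :
    (Set.image uQ) '' {S, Sᶜ} = {uQ '' S, (uQ '' S)ᶜ} := by
  rw [Set.image_pair, Set.image_compl_eq uQ.bijective]

/-- `u` preserves `M*` and commutes with negation, hence induces a permutation
of `Q` carrying sections of `φ` to sections, and a permutation of the `4`-element set `T`;
the latter has no fixed points and permutes the four elements of `T` cyclically. -/
theorem u_acts_cyclically_on_T :
    (∀ x ∈ MstarSet, uAut x ∈ MstarSet) ∧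
    (∀ x : Mfour, uAut (-x) = -(uAut x)) ∧
    ∃ uQ : Equiv.Perm Qneg,
      (∀ (x : Mstar) (h : uAut (x : Mfour) ∈ MstarSet),
        uQ ⟦x⟧ = ⟦(⟨uAut (x : Mfour), h⟩ : Mstar)⟧) ∧
      (∀ S : Set Qneg, IsSection S → IsSection (uQ '' S)) ∧
      (∀ t ∈ TSet, (Set.image uQ) '' t ∈ TSet) ∧
      (∀ t ∈ TSet, (Set.image uQ) '' t ≠ t) ∧
      (∀ t ∈ TSet, TSet = {t, (Set.image uQ) '' t,
        (Set.image uQ) '' ((Set.image uQ) '' t),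
        (Set.image uQ) '' ((Set.image uQ) '' ((Set.image uQ) '' t))}) := by
  refine ⟨u_Mstar, fun x => map_neg uAut x, uQ, fun _ _ => rfl, img_section, ?_, ?_, ?_⟩
  · rintro _ ⟨S, hS, rfl⟩
    exact ⟨uQ '' S, img_section S hS, img_pair S⟩
  · rintro _ ⟨S, hS, rfl⟩
    rw [img_pair, Ne, pair_eq, set_eq_iff, set_eq_iff]
    rw [isSection_iff] at hS
    simp only [mem_img, us_qa, us_qa', us_qb, us_qb', us_qc, us_qc', Set.mem_compl_iff]
    tauto
  · rintro _ ⟨S, hS, rfl⟩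
    have h1 := img_section _ hS
    have h2 := img_section _ h1
    have h3 := img_section _ h2
    simp only [img_pair]
    apply Set.Subset.antisymm
    · rintro _ ⟨R, hR, rfl⟩
      simp only [Set.mem_insert_iff, Set.mem_singleton_iff, pair_eq]
      simp only [set_eq_iff, mem_img, us_qa, us_qa', us_qb, us_qb', us_qc, us_qc',
        Set.mem_compl_iff]
      rw [isSection_iff] at hS hR
      obtain ⟨s1, s2, s3⟩ := hS
      obtain ⟨r1, r2, r3⟩ := hR
      simp only [s1, s2, s3, r1, r2, r3]
      clear s1 s2 s3 r1 r2 r3 h1 h2 h3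
      by_cases a1 : qa ∈ S <;> by_cases a2 : qb ∈ S <;> by_cases a3 : qc ∈ S <;>
      by_cases b1 : qa ∈ R <;> by_cases b2 : qb ∈ R <;> by_cases b3 : qc ∈ R <;>
      simp [a1, a2, a3, b1, b2, b3]
    · rintro _ (rfl | rfl | rfl | rfl)
      exacts [⟨_, hS, rfl⟩, ⟨_, h1, rfl⟩, ⟨_, h2, rfl⟩, ⟨_, h3, rfl⟩]
end

section
/- Let H be an abelian group. Define a cochain complex C^• of abelian groups by C^i = H^i (the direct sum of i copies of H, with C^0 = 0) and differential d^i = Σ_{j=0}^{i+1} (−1)^j δ_j : C^i → C^{i+1}, where δ_0(s₁,…,s_i) = (0, s₁,…, s_i), δ_j(s₁,…,s_i) = (s₁,…, s_j, s_j,…, s_i) for 1 ≤ j ≤ i, and δ_{i+1}(s₁,…,s_i) = (s₁,…, s_i, 0). Then the cohomology of C^• is H in degree 1 and zero in every other degree: H^1(C^•) ≅ H and H^i(C^•) = 0 for all i ≠ 1. -/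
/-- `H^i` padded: view `s : H^i` as a function on `ℕ` (1-indexed), zero outside `1,…,i`. -/
def pad {H : Type*} [AddCommGroup H] (i : ℕ) (s : Fin i → H) : ℕ → H :=
  fun k => if h : 1 ≤ k ∧ k ≤ i then s ⟨k - 1, by omega⟩ else 0

/-- The map `δ_j : H^i → H^{i+1}` (`0 ≤ j ≤ i+1`):
`δ_0 s = (0, s₁,…,s_i)`, `δ_j s = (s₁,…,s_j,s_j,…,s_i)` for `1 ≤ j ≤ i`, and
`δ_{i+1} s = (s₁,…,s_i, 0)`.  In 1-indexed terms, the `m`-th entry of `δ_j s` is `s_m`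
if `m ≤ j` and `s_{m−1}` otherwise (with `s_0 = s_{i+1} = 0`). -/
def coDegen {H : Type*} [AddCommGroup H] (i : ℕ) (j : ℕ) (s : Fin i → H) : Fin (i + 1) → H :=
  fun m => if (m : ℕ) + 1 ≤ j then pad i s ((m : ℕ) + 1) else pad i s (m : ℕ)

/-- The differential `d^i = ∑_{j=0}^{i+1} (−1)^j δ_j : H^i → H^{i+1}`. -/
def dBar (H : Type*) [AddCommGroup H] (i : ℕ) : (Fin i → H) →+ (Fin (i + 1) → H) where
  toFun s := fun m => ∑ j ∈ Finset.range (i + 2), ((-1 : ℤ) ^ j) • coDegen i j s m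
  map_zero' := by
    funext m
    have : ∀ j, coDegen i j (0 : Fin i → H) m = 0 := by
      intro j
      unfold coDegen pad
      split <;> (split <;> simp)
    simp [this]
  map_add' s t := by
    funext m
    have hpad : ∀ k, pad i (s + t) k = pad i s k + pad i t k := by
      intro k; unfold pad; split <;> simp
    have hco : ∀ j, coDegen i j (s + t) m = coDegen i j s m + coDegen i j t m := by
      intro j; unfold coDegen; split <;> simp [hpad]
    simp [hco, smul_add, Finset.sum_add_distrib]

theorem aux_sum {H : Type*} [AddCommGroup H] (a b : H) (p n : ℕ) :
    ∑ j ∈ Finset.range n, ((-1 : ℤ) ^ j) • (if p ≤ j then a else b) =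
      (if min n p % 2 = 1 then b else 0) + ((if n % 2 = 1 then a else 0)
        - (if min n p % 2 = 1 then a else 0)) := by
  induction n with
  | zero => simp
  | succ n ih =>
    rw [Finset.sum_range_succ, ih]
    rcases Nat.even_or_odd n with h | h
    · have h0 := Nat.even_iff.mp h
      have h1 : (n + 1) % 2 = 1 := by omega
      rw [h.neg_one_pow]
      by_cases hp : p ≤ n
      · rw [min_eq_right hp, min_eq_right (by omega : p ≤ n + 1)]
        simp [h0, h1, hp]
        abel
      · rw [min_eq_left (by omega : n ≤ p), min_eq_left (by omega : n + 1 ≤ p)]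
        simp [h0, h1, hp]
    · have h0 := Nat.odd_iff.mp h
      have h1 : (n + 1) % 2 = 0 := by omega
      rw [h.neg_one_pow]
      by_cases hp : p ≤ n
      · rw [min_eq_right hp, min_eq_right (by omega : p ≤ n + 1)]
        simp [h0, h1, hp]
        abel
      · rw [min_eq_left (by omega : n ≤ p), min_eq_left (by omega : n + 1 ≤ p)]
        simp [h0, h1, hp]

theorem dBar_formula {H : Type*} [AddCommGroup H] (i : ℕ) (s : Fin i → H) (m : Fin (i + 1)) :
    dBar H i s m = (if (m : ℕ) % 2 = 0 then pad i s m else 0)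
      + ((if i % 2 = 1 then pad i s (m + 1) else 0)
        - (if (m : ℕ) % 2 = 0 then pad i s (m + 1) else 0)) := by
  have h := aux_sum (pad i s ((m : ℕ) + 1)) (pad i s (m : ℕ)) ((m : ℕ) + 1) (i + 2)
  have e1 : min (i + 2) ((m : ℕ) + 1) = m + 1 := min_eq_right (by have := m.2; omega)
  have e2 : (((m : ℕ) + 1) % 2 = 1) = ((m : ℕ) % 2 = 0) := by
    apply propext; omega
  have e3 : ((i + 2) % 2 = 1) = (i % 2 = 1) := by
    apply propext; omega
  rw [e1] at h
  simp only [e2, e3] at h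
  exact h

theorem pad_in {H : Type*} [AddCommGroup H] (i : ℕ) (s : Fin i → H) (k : ℕ) (h : k < i) :
    pad i s (k + 1) = s ⟨k, h⟩ := by
  unfold pad
  rw [dif_pos ⟨by omega, by omega⟩]
  rfl

theorem pad_zero {H : Type*} [AddCommGroup H] (i : ℕ) (s : Fin i → H) : pad i s 0 = 0 := by
  simp [pad]

theorem pad_out {H : Type*} [AddCommGroup H] (i : ℕ) (s : Fin i → H) (k : ℕ) (h : i < k) :
    pad i s k = 0 := by
  unfold pad
  rw [dif_neg (by omega)]

theorem exact_aux {H : Type*} [AddCommGroup H] (i : ℕ) (s : Fin (i + 2) → H)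
    (hs : dBar H (i + 2) s = 0) : ∃ t, dBar H (i + 1) t = s := by
  have hk : ∀ k (h : k < i + 3), _ := fun k h =>
    (dBar_formula (i + 2) s ⟨k, h⟩).symm.trans (congrFun hs ⟨k, h⟩)
  simp only [Pi.zero_apply] at hk
  rcases Nat.mod_two_eq_zero_or_one i with hi | hi
  · refine ⟨fun k => s k.castSucc, ?_⟩
    have hp : ∀ k, k ≤ i + 1 → pad (i + 1) (fun k => s k.castSucc) k = pad (i + 2) s k := by
      intro k h
      rcases k with _ | k
      · simp [pad_zero]
      · rw [pad_in _ _ k (by omega), pad_in _ _ k (by omega)]; rfl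
    funext ⟨m, hm⟩
    rw [dBar_formula]
    have e := hk m (by omega)
    have e' := hk (m + 1) (by omega)
    rw [← pad_in _ s m hm]
    have q1 : (i + 2) % 2 = 0 := by omega
    have q2 : (i + 1) % 2 = 1 := by omega
    rcases Nat.mod_two_eq_zero_or_one m with h | h
    · simp only [h, q1, q2, if_true] at e ⊢
      rw [hp m (by omega)]
      simp at e ⊢
      exact sub_eq_zero.mp (by rw [sub_eq_add_neg]; exact e)
    · have h' : (m + 1) % 2 = 0 := by omega
      simp [h, q2]
      by_cases hmi : m + 1 ≤ i + 1
      · exact hp _ hmi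
      · rw [pad_out _ _ _ (by omega)]
        simp [h', q1] at e'
        rw [pad_out _ _ (m + 1 + 1) (by omega)] at e'
        simpa using e'.symm
  · let t : Fin (i + 1) → H := fun k => if (k : ℕ) = 0 then - s 0 else
      if (k : ℕ) % 2 = 1 then s k.succ else 0
    refine ⟨t, ?_⟩
    funext ⟨m, hm⟩
    rw [dBar_formula]
    have e := hk m (by omega)
    rw [← pad_in _ s m hm]
    have q1 : (i + 2) % 2 = 1 := by omega
    have q2 : (i + 1) % 2 = 0 := by omega
    rcases Nat.mod_two_eq_zero_or_one m with h | h
    · simp only [h, q2, if_true]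
      rcases m with _ | m
      · rw [pad_zero, pad_in _ _ 0 (by omega), pad_in _ _ 0 (by omega)]
        simp [t]
      · have h' : m % 2 = 1 := by omega
        have h0 : m ≠ 0 := by omega
        have z : pad (i + 1) t (m + 1 + 1) = 0 := by
          by_cases hmi : m + 1 < i + 1
          · rw [pad_in _ _ _ hmi]
            simp [t, h]
          · exact pad_out _ _ _ (by omega)
        rw [z, pad_in _ _ m (by omega), pad_in _ _ (m + 1) (by omega)]
        simp [t, h', h0]
    · simp [h, q1] at e
      simp [h, q2, e]

theorem dBar_one {H : Type*} [AddCommGroup H] (s : Fin 1 → H) : dBar H 1 s = 0 := by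
  funext ⟨m, hm⟩
  rw [dBar_formula]
  rcases m with _ | _ | m
  · simp [pad_zero]
  · simp [pad_out]
  · omega

/-- the cochain complex `C^i = H^i` (with `C^0 = 0`) and differential
`d^i = ∑_{j=0}^{i+1} (−1)^j δ_j` has cohomology `H` in degree `1` and `0` in every other
degree. -/
theorem cohomology_of_codegeneracy_complex (H : Type*) [AddCommGroup H] :
    Nonempty
      (((dBar H 1).ker ⧸ ((dBar H 0).range.addSubgroupOf (dBar H 1).ker)) ≃+ H) ∧
    (∀ x : (dBar H 0).ker, x = 0) ∧
    (∀ i : ℕ,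
      ∀ x : ((dBar H (i + 2)).ker ⧸ ((dBar H (i + 1)).range.addSubgroupOf (dBar H (i + 2)).ker)),
        x = 0) := by
  refine ⟨?_, ?_, ?_⟩
  · have hb : (dBar H 0).range.addSubgroupOf (dBar H 1).ker = ⊥ := by
      rw [eq_bot_iff]
      rintro ⟨x, hx⟩ h
      rw [AddSubgroup.mem_addSubgroupOf] at h
      obtain ⟨y, hy⟩ := h
      have : y = 0 := Subsingleton.elim _ _
      rw [this, map_zero] at hy
      exact AddSubgroup.mem_bot.mpr (Subtype.ext hy.symm)
    have ht : (dBar H 1).ker = ⊤ := by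
      rw [eq_top_iff]
      intro x _
      exact dBar_one x
    exact ⟨(QuotientAddGroup.quotientAddEquivOfEq hb).trans
      (QuotientAddGroup.quotientBot.trans ((AddEquiv.addSubgroupCongr ht).trans
        (AddSubgroup.topEquiv.trans (AddEquiv.piUnique (fun _ : Fin 1 => H)))))⟩
  · intro x
    exact Subsingleton.elim _ _
  · intro i x
    induction x using QuotientAddGroup.induction_on with
    | H x =>
      rw [QuotientAddGroup.eq_zero_iff, AddSubgroup.mem_addSubgroupOf]
      exact exact_aux i x.1 x.2
end
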